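/- Let N ≥ 1, k ≤ 1 a real number, and let L : Fin N → (EuclideanSpace ℝ (Fin d) → ℝ) be a family of loss functions, each differentiable at a point θ, with L i θ > 0 for all i. Define the sampling probabilities p i = L i θ / (Σ_j L j θ) and the biased importance weights α i = 1/(N · (p i)^k). Then the expected update direction satisfies Σ_i p i • (α i • ∇(L i) θ) = ((Σ_j L j θ)^(k−1) / (2−k)) • ((1/N) • Σ_i ∇(fun x ↦ (L i x)^(2−k)) θ), where ∇ denotes the Euclidean gradient; i.e., the biased importance-sampled gradient is, up to the positive scalar (Σ_j L j θ)^(k−1)/(2−k), an unbiased estimator of the gradient of the average of the losses raised to the power 2−k ≥ 1. -/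

import Mathlib

/-- Soft max-loss via biased importance sampling (Section 3.2 of the paper): with
loss-proportional probabilities `p_i = L_i(θ)/∑_j L_j(θ)` and biased weights
`α_i = 1/(N p_i^k)` for `k ≤ 1`, the expected update direction is, up to the positive scalar
`(∑_j L_j(θ))^(k-1)/(2-k)`, the gradient of the average of the losses raised to power `2-k`. -/
theorem biased_importance_soft_max_loss (N d : ℕ) (hN : 1 ≤ N) (k : ℝ) (hk : k ≤ 1)
    (L : Fin N → (EuclideanSpace ℝ (Fin d) → ℝ)) (θ : EuclideanSpace ℝ (Fin d))
    (hdiff : ∀ i, DifferentiableAt ℝ (L i) θ) (hpos : ∀ i, 0 < L i θ)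
    (p : Fin N → ℝ) (hp : ∀ i, p i = L i θ / ∑ j, L j θ)
    (α : Fin N → ℝ) (hα : ∀ i, α i = 1 / (N * (p i) ^ k)) :
    ∑ i, p i • (α i • gradient (L i) θ) =
      ((∑ j, L j θ) ^ (k - 1) / (2 - k)) •
        ((1 / (N : ℝ)) • ∑ i, gradient (fun x => (L i x) ^ (2 - k)) θ) := by
  have hg : ∀ i, gradient (fun x => (L i x) ^ (2 - k)) θ
      = ((2 - k) * (L i θ) ^ (2 - k - 1)) • gradient (L i) θ := by
    intro i
    apply HasGradientAt.gradient
    rw [hasGradientAt_iff_hasFDerivAt]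
    have h := (hdiff i).hasGradientAt.hasFDerivAt.rpow_const (p := 2 - k)
      (Or.inl (hpos i).ne')
    rw [map_smulₛₗ]
    exact h
  rw [Finset.smul_sum, Finset.smul_sum]
  refine Finset.sum_congr rfl fun i _ => ?_
  rw [hg i, smul_smul, smul_smul, smul_smul, hα i, hp i]
  congr 1
  have hS : 0 < ∑ j, L j θ :=
    Finset.sum_pos (fun j _ => hpos j) ⟨i, Finset.mem_univ i⟩
  have hl := hpos i
  generalize (∑ j, L j θ) = S at hS ⊢
  generalize L i θ = l at hl ⊢
  have hN' : (N : ℝ) ≠ 0 := by positivity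
  have h2 : (2 - k) ≠ 0 := by linarith
  have e : 2 - k - 1 = 1 - k := by ring
  rw [e, Real.div_rpow hl.le hS.le, Real.rpow_sub hS, Real.rpow_sub hl, Real.rpow_one,
    Real.rpow_one]
  have h3 := (Real.rpow_pos_of_pos hl k).ne'
  have h4 := (Real.rpow_pos_of_pos hS k).ne'
  field_simp
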